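/- Let X and Y be real-valued random variables on a probability space, let π be a probability law on ℝ, let p ∈ [1, ∞), and let A be an event with P(A) ≥ 1/K for some K ≥ 1. Assume that the conditional law of Y given A equals π and that the conditional law of X given A equals the (unconditional) law of X, and that E[|X − Y|^p] < ∞. Then the p-th power of the L^p-Wasserstein distance between the law of X and π is at most K E[|X − Y|^p]; that is, inf over couplings (X', Z) of ℒ(X) and π of E[|X' − Z|^p] ≤ K E[|X − Y|^p]. -/

import Mathlib

open MeasureTheory

/-- A coupling of two probability laws `μ` and `ν` on `ℝ`: a joint law on `ℝ × ℝ`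
whose first marginal is `μ` and second marginal is `ν`. -/
def IsCoupling (γ : Measure (ℝ × ℝ)) (μ ν : Measure ℝ) : Prop :=
  γ.map Prod.fst = μ ∧ γ.map Prod.snd = ν

/-- Conditioning on an event of probability at least `1 / K` increases the integral of a
nonnegative function by a factor of at most `K`. -/
lemma integral_cond_le_mul_integral {Ω : Type*} [MeasurableSpace Ω] {P : Measure Ω}
    [IsFiniteMeasure P] {A : Set Ω} {K : ℝ} (hK : 0 < K)
    (hPA : ENNReal.ofReal (1 / K) ≤ P A) {f : Ω → ℝ} (hf : 0 ≤ f) (hint : Integrable f P) :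
    ∫ ω, f ω ∂(ProbabilityTheory.cond P A) ≤ K * ∫ ω, f ω ∂P := by
  have hinv : (P A)⁻¹.toReal ≤ K := by
    have h : (P A)⁻¹ ≤ ENNReal.ofReal K := by
      rw [ENNReal.inv_le_iff_inv_le, ← ENNReal.ofReal_inv_of_pos hK, ← one_div]
      exact hPA
    exact ENNReal.toReal_le_of_le_ofReal hK.le h
  rw [ProbabilityTheory.cond, integral_smul_measure, smul_eq_mul]
  exact mul_le_mul hinv
    (setIntegral_le_integral hint (Filter.Eventually.of_forall hf)) (integral_nonneg hf) hK.le

/-- The joint law of `X` and `Y` given `A` is a coupling of the law of `X` and `pi` whose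
transport cost is finite and at most `K E[|X - Y|^p]`. -/
lemma exists_isCoupling_integrable_integral_le
    {Ω : Type*} [MeasurableSpace Ω] {P : Measure Ω} [IsFiniteMeasure P]
    {X Y : Ω → ℝ} (hX : Measurable X) (hY : Measurable Y) {pi : Measure ℝ} {p : ℝ}
    {A : Set Ω} {K : ℝ} (hK : 0 < K) (hPA : ENNReal.ofReal (1 / K) ≤ P A)
    (hYA : (ProbabilityTheory.cond P A).map Y = pi)
    (hXA : (ProbabilityTheory.cond P A).map X = P.map X)
    (hint : Integrable (fun ω => |X ω - Y ω| ^ p) P) :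
    ∃ γ : Measure (ℝ × ℝ), IsCoupling γ (P.map X) pi ∧
      Integrable (fun q : ℝ × ℝ => |q.1 - q.2| ^ p) γ ∧
      ∫ q, |q.1 - q.2| ^ p ∂γ ≤ K * ∫ ω, |X ω - Y ω| ^ p ∂P := by
  have hXY : Measurable fun ω => (X ω, Y ω) := hX.prodMk hY
  have hcost : Measurable fun q : ℝ × ℝ => |q.1 - q.2| ^ p := by fun_prop
  have hA0 : P A ≠ 0 :=
    ((ENNReal.ofReal_pos.2 (one_div_pos.2 hK)).trans_le hPA).ne'
  refine ⟨(ProbabilityTheory.cond P A).map fun ω => (X ω, Y ω), ⟨?_, ?_⟩, ?_, ?_⟩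
  · rw [Measure.map_map measurable_fst hXY]
    exact hXA
  · rw [Measure.map_map measurable_snd hXY]
    exact hYA
  · rw [integrable_map_measure hcost.aestronglyMeasurable hXY.aemeasurable]
    exact hint.restrict.smul_measure (ENNReal.inv_ne_top.2 hA0)
  · rw [integral_map hXY.aemeasurable hcost.aestronglyMeasurable]
    exact integral_cond_le_mul_integral hK hPA
      (fun ω => Real.rpow_nonneg (abs_nonneg _) p) hint

/-- Theorem 3.2 (abstract form): if `P(A) ≥ 1/K`, the conditional law of `Y` given `A`
is `π`, and the conditional law of `X` given `A` is the law of `X`, then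
`W_p(ℒ(X), π)^p ≤ K E[|X - Y|^p]`. -/
theorem stmt11
    {Ω : Type*} [MeasurableSpace Ω] (P : Measure Ω) [IsProbabilityMeasure P]
    (X Y : Ω → ℝ) (hX : Measurable X) (hY : Measurable Y)
    (pi : Measure ℝ) [IsProbabilityMeasure pi]
    (p : ℝ) (hp : 1 ≤ p)
    (A : Set Ω) (hA : MeasurableSet A)
    (K : ℝ) (hK : 1 ≤ K) (hPA : ENNReal.ofReal (1 / K) ≤ P A)
    (hYA : (ProbabilityTheory.cond P A).map Y = pi)
    (hXA : (ProbabilityTheory.cond P A).map X = P.map X)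
    (hint : Integrable (fun ω => |X ω - Y ω| ^ p) P) :
    sInf {r : ℝ | ∃ γ : Measure (ℝ × ℝ), IsCoupling γ (P.map X) pi ∧
        r = ∫ q, |q.1 - q.2| ^ p ∂γ}
      ≤ K * ∫ ω, |X ω - Y ω| ^ p ∂P := by
  obtain ⟨γ, hγ, -, hle⟩ := exists_isCoupling_integrable_integral_le hX hY
    (zero_lt_one.trans_le hK) hPA hYA hXA hint
  refine le_trans (csInf_le ⟨0, ?_⟩ ⟨γ, hγ, rfl⟩) hle
  rintro r ⟨_, -, rfl⟩
  exact integral_nonneg fun q => Real.rpow_nonneg (abs_nonneg _) p
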